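/- There exists a function C₂ of one real variable such that: for every F ∈ C²(T⁵) satisfying the normalization (N) ∫_{[0,1]⁵}(e^F − 1) dx = 0, and every φ ∈ C⁴(T⁵) with ∫_{[−1/2,1/2]⁵} φ = 0 solving equation (★), one has ‖φ‖_{C¹} ≤ C₂(‖F‖_{C²}). -/

import Mathlib

open MeasureTheory

/-- Partial derivative in the `i`-th coordinate direction. -/
noncomputable def pd {n : ℕ} (i : Fin n) (f : (Fin n → ℝ) → ℝ) : (Fin n → ℝ) → ℝ :=
  fun x => fderiv ℝ f x (Pi.single i 1)

/-- Second partial derivative `∂²f/∂x^i∂x^j`. -/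
noncomputable def pd2 {n : ℕ} (i j : Fin n) (f : (Fin n → ℝ) → ℝ) : (Fin n → ℝ) → ℝ :=
  pd i (pd j f)

/-- A function on `ℝⁿ` that is `1`-periodic in every coordinate, i.e. a function on `Tⁿ`. -/
def PeriodicPi {n : ℕ} (f : (Fin n → ℝ) → ℝ) : Prop :=
  ∀ x : Fin n → ℝ, ∀ i : Fin n, f (x + Pi.single i 1) = f x

/-- The Euclidean Laplacian. -/
noncomputable def lap {n : ℕ} (f : (Fin n → ℝ) → ℝ) : (Fin n → ℝ) → ℝ :=
  fun x => ∑ i, pd2 i i f x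

/-- Equation (★): the reduction of the quaternionic Monge–Ampère equation to `T⁵`. -/
def EqStar (F φ : (Fin 5 → ℝ) → ℝ) : Prop :=
  ∀ x : Fin 5 → ℝ,
    (pd2 0 0 φ x + pd2 1 1 φ x + pd2 2 2 φ x + pd2 3 3 φ x + 1) * (pd2 4 4 φ x + 1)
      - (pd2 0 4 φ x) ^ 2 - (pd2 1 4 φ x) ^ 2 - (pd2 2 4 φ x) ^ 2 - (pd2 3 4 φ x) ^ 2
      = Real.exp (F x)

/-- Iterated partial derivative `∂^I f` for a multi-index `I`. -/
noncomputable def pdI {n : ℕ} (I : Fin n → ℕ) (f : (Fin n → ℝ) → ℝ) : (Fin n → ℝ) → ℝ :=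
  (List.finRange n).foldr (fun i g => (pd i)^[I i] g) f

/-- The `Cᵏ`-norm `max_{|I| ≤ k} sup_x |∂^I f(x)|`. -/
noncomputable def CNorm {n : ℕ} (k : ℕ) (f : (Fin n → ℝ) → ℝ) : ℝ :=
  ⨆ I : Fin n → ℕ, ⨆ _ : (∑ i, I i) ≤ k, ⨆ x : Fin n → ℝ, |pdI I f x|

section PartialDerivatives

variable {n : ℕ} {f : (Fin n → ℝ) → ℝ}

theorem contDiff_pd {m k : WithTop ℕ∞} (hf : ContDiff ℝ m f) (hk : k + 1 ≤ m) (i : Fin n) :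
    ContDiff ℝ k (pd i f) :=
  (hf.fderiv_right hk).clm_apply contDiff_const

theorem fderiv_eq_sum_pd (x v : Fin n → ℝ) : fderiv ℝ f x v = ∑ i, v i * pd i f x := by
  conv_lhs => rw [pi_eq_sum_univ' v]
  simp [pd, map_sum]

theorem hasDerivAt_line (hf : Differentiable ℝ f) (x v : Fin n → ℝ) (t : ℝ) :
    HasDerivAt (fun s : ℝ => f (x + s • v)) (∑ i, v i * pd i f (x + t • v)) t := by
  rw [← fderiv_eq_sum_pd]
  have h : HasDerivAt (fun s : ℝ => x + s • v) v t := by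
    simpa using ((hasDerivAt_id t).smul_const v).const_add x
  exact (hf (x + t • v)).hasFDerivAt.comp_hasDerivAt t h

theorem hasDerivAt_pd (hf : Differentiable ℝ f) (x : Fin n → ℝ) (i : Fin n) :
    HasDerivAt (fun s : ℝ => f (x + s • Pi.single i 1)) (pd i f x) 0 := by
  simpa [Pi.single_apply] using hasDerivAt_line hf x (Pi.single i 1) 0

theorem pd_comm (hf : ContDiff ℝ 2 f) (i j : Fin n) : pd i (pd j f) = pd j (pd i f) := by
  funext x
  have hd : DifferentiableAt ℝ (fderiv ℝ f) x :=
    ((hf.fderiv_right (m := 1) (by norm_num)).differentiable (by norm_num)) x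
  have key : ∀ a b : Fin n,
      pd a (pd b f) x = fderiv ℝ (fderiv ℝ f) x (Pi.single a 1) (Pi.single b 1) := by
    intro a b
    unfold pd
    rw [fderiv_clm_apply hd (by fun_prop)]
    simp
  rw [key, key]
  exact (hf.contDiffAt.isSymmSndFDerivAt (by simp)) _ _

/-- Second derivative test at a maximum in one variable. -/
theorem deriv_deriv_nonpos_of_forall_le {g g' : ℝ → ℝ} {c : ℝ} (hg : ∀ t, HasDerivAt g (g' t) t)
    (hg' : HasDerivAt g' c 0) (hmax : ∀ t, g t ≤ g 0) : c ≤ 0 := by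
  by_contra! hc
  have hd : deriv g = g' := funext fun t => (hg t).deriv
  have hloc : IsLocalMax g 0 := Filter.Eventually.of_forall hmax
  have hmin : IsLocalMin g 0 := by
    apply isLocalMin_of_deriv_deriv_pos
    · rw [hd, hg'.deriv]; exact hc
    · exact hloc.deriv_eq_zero
    · exact (hg 0).continuousAt
  have hconst : g =ᶠ[nhds 0] fun _ => g 0 := by
    filter_upwards [hmin] with t ht using le_antisymm (hmax t) ht
  have h2 : deriv (deriv g) 0 = 0 := by
    rw [hconst.deriv.deriv_eq]; simp
  rw [hd, hg'.deriv] at h2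
  exact hc.ne' h2

theorem hessian_nonpos_of_forall_le (hf : ContDiff ℝ 2 f) {x : Fin n → ℝ}
    (hmax : ∀ y, f y ≤ f x) (v : Fin n → ℝ) :
    ∑ i, v i * ∑ j, v j * pd j (pd i f) x ≤ 0 := by
  refine deriv_deriv_nonpos_of_forall_le
    (hasDerivAt_line (hf.differentiable (by norm_num)) x v) ?_ (by simpa using fun t => hmax _)
  refine HasDerivAt.fun_sum fun i _ => HasDerivAt.const_mul _ ?_
  simpa using hasDerivAt_line
    ((contDiff_pd (k := 1) hf (by norm_num) i).differentiable (by norm_num)) x v 0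

theorem pd_eq_zero_of_forall_le {x : Fin n → ℝ} (hmax : ∀ y, f y ≤ f x) (i : Fin n) :
    pd i f x = 0 := by
  have h : IsLocalMax f x := Filter.Eventually.of_forall hmax
  simp [pd, h.fderiv_eq_zero]

end PartialDerivatives

section Periodic

variable {n : ℕ} {f : (Fin n → ℝ) → ℝ}

theorem PeriodicPi.pd (hf : PeriodicPi f) (i : Fin n) : PeriodicPi (pd i f) := by
  intro x j
  have h : (fun y => f (y + Pi.single j 1)) = f := funext fun y => hf y j
  unfold _root_.pd
  rw [← fderiv_comp_add_right, h]

theorem PeriodicPi.fract (hf : PeriodicPi f) (x : Fin n → ℝ) :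
    f (fun i => Int.fract (x i)) = f x := by
  have h1 : ∀ (i : Fin n) (k : ℤ) (y : Fin n → ℝ), f (y - k • Pi.single i 1) = f y := by
    intro i k y
    have : Function.Periodic f (Pi.single i 1) := fun y => hf y i
    exact (this.zsmul k).sub_eq y
  have h2 : ∀ s : Finset (Fin n), f (x - ∑ i ∈ s, ⌊x i⌋ • Pi.single i 1) = f x := by
    intro s
    induction s using Finset.induction_on with
    | empty => simp
    | insert a s ha ih =>
      rw [Finset.sum_insert ha, add_comm, ← sub_sub, h1, ih]
  rw [← h2 Finset.univ]
  congr 1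
  funext j
  simp [Finset.sum_apply, Pi.single_apply]

theorem PeriodicPi.exists_max (hf : PeriodicPi f) (hc : Continuous f) :
    ∃ x ∈ Set.Icc (0 : Fin n → ℝ) 1, ∀ y, f y ≤ f x := by
  obtain ⟨x, hx, hmax⟩ := (isCompact_Icc (a := (0 : Fin n → ℝ)) (b := 1)).exists_isMaxOn
    ⟨0, by simp⟩ hc.continuousOn
  refine ⟨x, hx, fun y => ?_⟩
  rw [← hf.fract y]
  exact hmax ⟨fun i => Int.fract_nonneg _, fun i => (Int.fract_lt_one _).le⟩

theorem PeriodicPi.exists_min (hf : PeriodicPi f) (hc : Continuous f) :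
    ∃ x ∈ Set.Icc (0 : Fin n → ℝ) 1, ∀ y, f x ≤ f y := by
  obtain ⟨x, hx, h⟩ := PeriodicPi.exists_max (f := fun x => -f x)
    (fun x i => by simp [hf x i]) hc.neg
  exact ⟨x, hx, fun y => neg_le_neg_iff.mp (h y)⟩

theorem PeriodicPi.bddAbove_abs (hf : PeriodicPi f) (hc : Continuous f) :
    BddAbove (Set.range fun x => |f x|) := by
  obtain ⟨x, -, h⟩ := PeriodicPi.exists_max (f := fun x => |f x|)
    (fun x i => by simp [hf x i]) hc.abs
  exact ⟨|f x|, by rintro _ ⟨y, rfl⟩; exact h y⟩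

end Periodic

section CNormBounds

variable {n : ℕ} {f : (Fin n → ℝ) → ℝ}

theorem pdI_zero : pdI 0 f = f := by
  have : ∀ l : List (Fin n),
      l.foldr (fun i g => (pd i)^[(0 : Fin n → ℕ) i] g) f = f := by
    intro l
    induction l with
    | nil => rfl
    | cons a l ih => rw [List.foldr_cons, ih]; simp
  exact this _

theorem pdI_single (k : Fin n) : pdI (Pi.single k 1) f = pd k f := by
  have h : ∀ l : List (Fin n), l.Nodup →
      l.foldr (fun i g => (pd i)^[(Pi.single k 1 : Fin n → ℕ) i] g) f
        = if k ∈ l then pd k f else f := by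
    intro l hl
    induction l with
    | nil => simp
    | cons a l ih =>
      rw [List.nodup_cons] at hl
      rw [List.foldr_cons, ih hl.2]
      by_cases hak : k = a
      · subst hak; simp [hl.1]
      · simp [hak, Ne.symm hak]
  rw [pdI, h _ (List.nodup_finRange n)]
  simp

theorem abs_pdI_le_CNorm {k : ℕ} {I : Fin n → ℕ} (hI : ∑ i, I i ≤ k)
    (hb : BddAbove (Set.range fun x => |pdI I f x|)) (x : Fin n → ℝ) :
    |pdI I f x| ≤ CNorm k f := by
  have hfin : {J : Fin n → ℕ | ∑ i, J i ≤ k}.Finite := by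
    refine (Set.finite_Iic (fun _ : Fin n => k)).subset fun J hJ i => ?_
    exact (Finset.single_le_sum (fun _ _ => Nat.zero_le _) (Finset.mem_univ i)).trans hJ
  have hbdd : BddAbove (Set.range fun J : Fin n → ℕ =>
      ⨆ _ : (∑ i, J i) ≤ k, ⨆ x : Fin n → ℝ, |pdI J f x|) := by
    refine ((hfin.image fun J => ⨆ x : Fin n → ℝ, |pdI J f x|).insert 0).bddAbove.mono ?_
    rintro _ ⟨J, rfl⟩
    by_cases hJ : ∑ i, J i ≤ k
    · right
      exact ⟨J, hJ, by simp [hJ]⟩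
    · left
      simp [hJ]
  refine (le_ciSup hb x).trans ?_
  refine le_trans (le_of_eq ?_) (le_ciSup hbdd I)
  simp [hI]

theorem CNorm_one_le {C : ℝ} (hC : 0 ≤ C) (h0 : ∀ x, |f x| ≤ C)
    (h1 : ∀ i x, |pd i f x| ≤ C) : CNorm 1 f ≤ C := by
  refine Real.iSup_le (fun I => Real.iSup_le (fun hI => Real.iSup_le (fun x => ?_) hC) hC) hC
  by_cases hz : I = 0
  · subst hz; rw [pdI_zero]; exact h0 x
  · obtain ⟨k, hk⟩ := Function.ne_iff.mp hz
    have hsum := Finset.add_sum_erase Finset.univ I (Finset.mem_univ k)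
    have hkI : I = Pi.single k 1 := by
      funext j
      by_cases hj : j = k
      · subst hj; simp at hk ⊢; omega
      · have := Finset.single_le_sum (f := I) (fun _ _ => Nat.zero_le _)
          (Finset.mem_erase.mpr ⟨hj, Finset.mem_univ j⟩)
        simp [hj] at hk ⊢; omega
    rw [hkI, pdI_single]; exact h1 k x

end CNormBounds

/-- The linearization of (★) with coefficients `A`, `B`, `w`, applied to a Hessian `X`. -/
def linStar (A B : ℝ) (w : Fin 5 → ℝ) (X : Fin 5 → Fin 5 → ℝ) : ℝ :=
  B * (X 0 0 + X 1 1 + X 2 2 + X 3 3) + A * X 4 4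
    - 2 * (w 0 * X 0 4 + w 1 * X 1 4 + w 2 * X 2 4 + w 3 * X 3 4)

theorem linStar_nonpos {A B e : ℝ} {w : Fin 5 → ℝ} (hB : 0 < B) (he : 0 < e)
    (h : A * B - w 0 ^ 2 - w 1 ^ 2 - w 2 ^ 2 - w 3 ^ 2 = e) {X : Fin 5 → Fin 5 → ℝ}
    (hsymm : ∀ i j, X i j = X j i) (hX : ∀ v : Fin 5 → ℝ, ∑ i, v i * ∑ j, v j * X j i ≤ 0) :
    linStar A B w X ≤ 0 := by
  have h0 := hX ![B, 0, 0, 0, -w 0]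
  have h1 := hX ![0, B, 0, 0, -w 1]
  have h2 := hX ![0, 0, B, 0, -w 2]
  have h3 := hX ![0, 0, 0, B, -w 3]
  have h4 := hX ![0, 0, 0, 0, 1]
  simp [Fin.sum_univ_five] at h0 h1 h2 h3 h4
  rw [hsymm 4 0] at h0
  rw [hsymm 4 1] at h1
  rw [hsymm 4 2] at h2
  rw [hsymm 4 3] at h3
  have h5 : e * X 4 4 ≤ 0 := mul_nonpos_of_nonneg_of_nonpos he.le h4
  have hmul : B * linStar A B w X ≤ 0 := by
    subst h
    unfold linStar
    linarith
  exact nonpos_of_mul_nonpos_right hmul hB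

theorem linStar_quadratic_ge {A B e : ℝ} {w : Fin 5 → ℝ}
    (h : A * B - w 0 ^ 2 - w 1 ^ 2 - w 2 ^ 2 - w 3 ^ 2 = e) (ξ : Fin 5 → ℝ) :
    e * ∑ i, ξ i ^ 2 ≤ (A + B) * linStar A B w (fun i j => ξ i * ξ j) := by
  subst h
  simp only [Fin.sum_univ_five, linStar]
  nlinarith [sq_nonneg (B * ξ 0 - ξ 4 * w 0), sq_nonneg (B * ξ 1 - ξ 4 * w 1),
    sq_nonneg (B * ξ 2 - ξ 4 * w 2), sq_nonneg (B * ξ 3 - ξ 4 * w 3),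
    sq_nonneg (A * ξ 4 - (w 0 * ξ 0 + w 1 * ξ 1 + w 2 * ξ 2 + w 3 * ξ 3)),
    sq_nonneg (w 0 * ξ 1 - w 1 * ξ 0), sq_nonneg (w 0 * ξ 2 - w 2 * ξ 0),
    sq_nonneg (w 0 * ξ 3 - w 3 * ξ 0), sq_nonneg (w 1 * ξ 2 - w 2 * ξ 1),
    sq_nonneg (w 1 * ξ 3 - w 3 * ξ 1), sq_nonneg (w 2 * ξ 3 - w 3 * ξ 2)]

/-- The pointwise inequality extracted from the maximum principle. -/
theorem bound_of_max_inequality {e m T Q p R : ℝ} (he : 0 < e) (hm : 0 < m) (hT : 0 < T)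
    (hmax : 2 * Q + 2 * e * p ≤ m * (2 * e - T)) (hQ : e * (m ^ 2 / 4) ≤ T * Q)
    (hp : p ^ 2 ≤ R * m ^ 2) : m ≤ 16 * e * (1 + R) := by
  have hQ0 : 0 ≤ Q := by
    by_contra! hneg
    have : 0 ≤ e * (m ^ 2 / 4) := by positivity
    nlinarith [mul_neg_of_pos_of_neg hT hneg]
  set q := |p| with hq
  have hq0 : 0 ≤ q := abs_nonneg p
  have hq2 : q ^ 2 ≤ R * m ^ 2 := by rw [hq, sq_abs]; exact hp
  have hpq : -p ≤ q := neg_le_abs p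
  have hepq : e * -p ≤ e * q := mul_le_mul_of_nonneg_left hpq he.le
  have hT1 : m * T ≤ 2 * e * (m + q) := by nlinarith
  have hQ1 : Q ≤ e * (m + q) := by nlinarith [mul_pos hm hT]
  have h1 : m ^ 2 ≤ 4 * T * (m + q) := by
    have : e * m ^ 2 ≤ e * (4 * T * (m + q)) := by nlinarith [mul_le_mul_of_nonneg_left hQ1 hT.le]
    exact le_of_mul_le_mul_left this he
  have h2 : m ^ 3 ≤ 8 * e * (m + q) ^ 2 := by
    nlinarith [mul_le_mul_of_nonneg_left h1 hm.le,
      mul_le_mul_of_nonneg_right hT1 (add_nonneg hm.le hq0)]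
  have h3 : (m + q) ^ 2 ≤ 2 * (1 + R) * m ^ 2 := by nlinarith [sq_nonneg (m - q)]
  have h4 : m ^ 2 * m ≤ m ^ 2 * (16 * e * (1 + R)) := by
    nlinarith [mul_le_mul_of_nonneg_left h3 he.le]
  exact le_of_mul_le_mul_left h4 (by positivity)

section Solution

variable {F φ : (Fin 5 → ℝ) → ℝ}

theorem EqStar.coeff_pos (hφ : ContDiff ℝ 4 φ) (hper : PeriodicPi φ) (h : EqStar F φ)
    (x : Fin 5 → ℝ) :
    0 < pd2 0 0 φ x + pd2 1 1 φ x + pd2 2 2 φ x + pd2 3 3 φ x + 1 ∧ 0 < pd2 4 4 φ x + 1 := by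
  have hc : Continuous fun x => pd2 4 4 φ x + 1 :=
    (contDiff_pd (k := 2) (contDiff_pd (k := 3) hφ (by norm_num) 4)
      (by norm_num) 4).continuous.add continuous_const
  have hprod : ∀ x, 0 < (pd2 0 0 φ x + pd2 1 1 φ x + pd2 2 2 φ x + pd2 3 3 φ x + 1)
      * (pd2 4 4 φ x + 1) := fun x => by
    have := h x
    nlinarith [Real.exp_pos (F x), sq_nonneg (pd2 0 4 φ x), sq_nonneg (pd2 1 4 φ x),
      sq_nonneg (pd2 2 4 φ x), sq_nonneg (pd2 3 4 φ x)]
  have hB : 0 < pd2 4 4 φ x + 1 := by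
    by_contra! hneg
    obtain ⟨z, -, hz⟩ := hper.exists_min hφ.continuous
    have hz4 : 0 ≤ pd2 4 4 φ z := by
      have hpd : ∀ g : (Fin 5 → ℝ) → ℝ, pd 4 (fun x => -g x) = fun x => -pd 4 g x := by
        intro g; funext y; simp [pd, fderiv_fun_neg]
      have := hessian_nonpos_of_forall_le (f := fun x => -φ x) (x := z)
        (hφ.neg.of_le (by norm_num)) (fun y => neg_le_neg (hz y)) (Pi.single 4 1)
      simp [Pi.single_apply, hpd] at this
      exact this
    obtain ⟨y, hy⟩ := mem_range_of_exists_le_of_exists_ge hc ⟨x, hneg⟩ ⟨z, by linarith⟩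
    have := hprod y
    simp only at hy
    rw [hy] at this
    simp at this
  exact ⟨pos_of_mul_pos_left (hprod x) hB.le, hB⟩

/-- The differentiated equation. -/
theorem EqStar.linStar_pd (hF : ContDiff ℝ 2 F) (hφ : ContDiff ℝ 4 φ) (h : EqStar F φ)
    (x : Fin 5 → ℝ) (k : Fin 5) :
    linStar (pd2 0 0 φ x + pd2 1 1 φ x + pd2 2 2 φ x + pd2 3 3 φ x + 1) (pd2 4 4 φ x + 1)
      (fun i => pd2 i 4 φ x) (fun i j => pd i (pd j (pd k φ)) x) = Real.exp (F x) * pd k F x := by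
  have hcomm : ∀ i j, pd i (pd j (pd k φ)) = pd k (pd2 i j φ) := by
    intro i j
    unfold pd2
    rw [pd_comm (hφ.of_le (by norm_num)) j k,
      pd_comm (contDiff_pd (k := 2) hφ (by norm_num) j) i k]
  have hd : ∀ i j, HasDerivAt (fun s : ℝ => pd2 i j φ (x + s • Pi.single k 1))
      (pd k (pd2 i j φ) x) 0 := fun i j =>
    hasDerivAt_pd ((contDiff_pd (k := 2) (contDiff_pd (k := 3) hφ (by norm_num) j)
      (by norm_num) i).differentiable (by norm_num)) x k
  have hL := (((((((((hd 0 0).add (hd 1 1)).add (hd 2 2)).add (hd 3 3)).add_const 1).mul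
    ((hd 4 4).add_const 1)).sub ((hd 0 4).pow 2)).sub ((hd 1 4).pow 2)).sub
    ((hd 2 4).pow 2)).sub ((hd 3 4).pow 2)
  have hR := (hasDerivAt_pd (hF.differentiable (by norm_num)) x k).exp
  have hEq := hL.unique (hR.congr_of_eventuallyEq
    (Filter.Eventually.of_forall fun s => h (x + s • Pi.single k 1)))
  simp at hEq
  simp only [linStar, hcomm]
  linarith

theorem pd_pd_gradient_comparison (hφ : ContDiff ℝ 4 φ) (m c : ℝ) :
    let Ψ := fun x => 1 + ∑ k, pd k φ x ^ 2 - m * (1 + φ x - c)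
    ContDiff ℝ 2 Ψ ∧
    (∀ i x, pd i Ψ x = 2 * ∑ k, pd k φ x * pd i (pd k φ) x - m * pd i φ x) ∧
    ∀ i j x, pd i (pd j Ψ) x = 2 * ∑ k, (pd i (pd k φ) x * pd j (pd k φ) x
      + pd k φ x * pd i (pd j (pd k φ)) x) - m * pd i (pd j φ) x := by
  intro Ψ
  have h1 : ∀ k, ContDiff ℝ 3 (pd k φ) := fun k => contDiff_pd hφ (by norm_num) k
  have h2 : ∀ i k, ContDiff ℝ 2 (pd i (pd k φ)) := fun i k => contDiff_pd (h1 k) (by norm_num) i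
  have hΨ : ContDiff ℝ 2 Ψ := by
    have h1' : ∀ k, ContDiff ℝ 2 (pd k φ) := fun k => (h1 k).of_le (by norm_num)
    have h0' : ContDiff ℝ 2 φ := hφ.of_le (by norm_num)
    fun_prop
  have hd0 := hφ.differentiable (by norm_num)
  have hd1 := fun k => (h1 k).differentiable (by norm_num)
  have hd2 := fun i k => (h2 i k).differentiable (by norm_num)
  have hfirst : ∀ i x, pd i Ψ x = 2 * ∑ k, pd k φ x * pd i (pd k φ) x - m * pd i φ x := by
    intro i x
    have hL := hasDerivAt_pd (hΨ.differentiable (by norm_num)) x i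
    have hR := ((HasDerivAt.fun_sum (u := Finset.univ) fun k _ =>
      (hasDerivAt_pd (hd1 k) x i).pow 2).const_add 1).sub
      ((((hasDerivAt_pd hd0 x i).const_add 1).sub_const c).const_mul m)
    refine (hL.unique hR).trans ?_
    simp [Finset.mul_sum, mul_assoc]
  refine ⟨hΨ, hfirst, fun i j x => ?_⟩
  have hL := hasDerivAt_pd ((contDiff_pd (k := 1) hΨ (by norm_num) j).differentiable
    (by norm_num)) x i
  simp only [hfirst] at hL
  have hR := ((HasDerivAt.fun_sum (u := Finset.univ) fun k _ =>
      (hasDerivAt_pd (hd1 k) x i).mul (hasDerivAt_pd (hd2 j k) x i)).const_mul 2).sub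
      ((hasDerivAt_pd (hd1 j) x i).const_mul m)
  refine (hL.unique hR).trans ?_
  simp

/-- The gradient estimate at a maximum of `(1 + |∇φ|²) / (1 + φ - c)`. -/
theorem EqStar.quotient_le (hF : ContDiff ℝ 2 F) (hφ : ContDiff ℝ 4 φ) (hper : PeriodicPi φ)
    (h : EqStar F φ) {m c N S : ℝ} (hm : 1 < m) {x : Fin 5 → ℝ}
    (hle : ∀ y, 1 + ∑ k, pd k φ y ^ 2 ≤ m * (1 + φ y - c))
    (hx : 1 + ∑ k, pd k φ x ^ 2 = m * (1 + φ x - c))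
    (hcx : c ≤ φ x) (hS : 1 + φ x - c ≤ S) (hSm : S ≤ 2 + 5 * m)
    (hN : |F x| ≤ N) (hN' : ∀ k, |pd k F x| ≤ N) :
    m ≤ 16 * Real.exp N * (1 + 35 * N ^ 2) := by
  obtain ⟨hA, hB⟩ := h.coeff_pos hφ hper x
  have heq : (pd2 0 0 φ x + pd2 1 1 φ x + pd2 2 2 φ x + pd2 3 3 φ x + 1) * (pd2 4 4 φ x + 1)
      - (pd2 0 4 φ x) ^ 2 - (pd2 1 4 φ x) ^ 2 - (pd2 2 4 φ x) ^ 2 - (pd2 3 4 φ x) ^ 2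
      = Real.exp (F x) := h x
  have hlin := h.linStar_pd hF hφ x
  obtain ⟨hΨ, hΨ1, hΨ2⟩ := pd_pd_gradient_comparison hφ m c
  set Ψ := fun x => 1 + ∑ k, pd k φ x ^ 2 - m * (1 + φ x - c) with hΨdef
  have hΨmax : ∀ y, Ψ y ≤ Ψ x := fun y => by
    simp only [hΨdef]; linarith [hle y]
  have hgrad : ∀ i, ∑ k, pd k φ x * pd i (pd k φ) x = m / 2 * pd i φ x := fun i => by
    have := (hΨ1 i x).symm.trans (pd_eq_zero_of_forall_le hΨmax i)
    linarith
  have hnonpos := linStar_nonpos (w := fun i => pd2 i 4 φ x) hB (Real.exp_pos _) heq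
    (X := fun i j => pd i (pd j Ψ) x) (fun i j => congrFun (pd_comm hΨ i j) x)
    (hessian_nonpos_of_forall_le hΨ hΨmax)
  have hquad := fun k => linStar_quadratic_ge (w := fun i => pd2 i 4 φ x) heq
    (fun i => pd i (pd k φ) x)
  set A := pd2 0 0 φ x + pd2 1 1 φ x + pd2 2 2 φ x + pd2 3 3 φ x + 1 with hAdef
  set B := pd2 4 4 φ x + 1 with hBdef
  set e := Real.exp (F x) with hedef
  set g := ∑ k, pd k φ x ^ 2 with hg
  have hg0 : 0 < g := by nlinarith
  refine le_trans (bound_of_max_inequality (e := e) (m := m) (T := A + B)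
    (Q := ∑ k, linStar A B (fun i => pd2 i 4 φ x) (fun i j => pd i (pd k φ) x * pd j (pd k φ) x))
    (p := ∑ k, pd k φ x * pd k F x) (R := 35 * N ^ 2) (Real.exp_pos _) (by linarith)
    (by linarith) ?_ ?_ ?_) ?_
  · have hLφ : linStar A B (fun i => pd2 i 4 φ x) (fun i j => pd i (pd j φ) x)
        = 2 * e - A - B := by
      rw [← heq]
      simp only [linStar, hAdef, hBdef, pd2]
      ring
    have hexp : linStar A B (fun i => pd2 i 4 φ x) (fun i j => pd i (pd j Ψ) x)
        = 2 * ∑ k, (linStar A B (fun i => pd2 i 4 φ x)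
            (fun i j => pd i (pd k φ) x * pd j (pd k φ) x)
          + pd k φ x * linStar A B (fun i => pd2 i 4 φ x) (fun i j => pd i (pd j (pd k φ)) x))
          - m * linStar A B (fun i => pd2 i 4 φ x) (fun i j => pd i (pd j φ) x) := by
      simp only [hΨ2, linStar, Fin.sum_univ_five]
      ring
    rw [hLφ] at hexp
    simp only [hlin] at hexp
    have hsum : ∑ k, pd k φ x * (e * pd k F x) = e * ∑ k, pd k φ x * pd k F x := by
      rw [Finset.mul_sum]; exact Finset.sum_congr rfl fun k _ => by ring
    rw [Finset.sum_add_distrib, hsum] at hexp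
    linarith
  · have hD : m ^ 2 / 4 ≤ ∑ k, ∑ i, pd i (pd k φ) x ^ 2 := by
      have hcs : ∑ i, (m / 2 * pd i φ x) ^ 2 ≤ ∑ i, g * ∑ k, pd i (pd k φ) x ^ 2 :=
        Finset.sum_le_sum fun i _ => by
          rw [← hgrad i]; exact Finset.sum_mul_sq_le_sq_mul_sq _ _ _
      simp only [mul_pow] at hcs
      rw [← Finset.mul_sum, ← Finset.mul_sum, ← hg, Finset.sum_comm] at hcs
      refine le_of_mul_le_mul_left ?_ hg0
      linarith
    rw [Finset.mul_sum]
    refine (mul_le_mul_of_nonneg_left hD (Real.exp_pos _).le).trans ?_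
    rw [Finset.mul_sum]
    exact Finset.sum_le_sum fun k _ => hquad k
  · have hcs := Finset.sum_mul_sq_le_sq_mul_sq Finset.univ (fun k => pd k φ x) (fun k => pd k F x)
    have hFN : ∑ k, pd k F x ^ 2 ≤ 5 * N ^ 2 := by
      refine (Finset.sum_le_card_nsmul _ _ (N ^ 2) fun k _ => ?_).trans (by simp)
      exact sq_le_sq' (abs_le.mp (hN' k)).1 (abs_le.mp (hN' k)).2
    have hg7 : g ≤ 7 * m ^ 2 := by nlinarith
    calc _ ≤ g * ∑ k, pd k F x ^ 2 := hcs
      _ ≤ (7 * m ^ 2) * (5 * N ^ 2) := by gcongr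
      _ = _ := by ring
  · have : e ≤ Real.exp N := Real.exp_le_exp.mpr ((le_abs_self _).trans hN)
    gcongr

end Solution

theorem sq_sub_le_of_sum_sq_pd_le {n : ℕ} {f : (Fin n → ℝ) → ℝ} (hf : Differentiable ℝ f)
    {K : ℝ} (hK : ∀ x, ∑ k, pd k f x ^ 2 ≤ K) {y z : Fin n → ℝ}
    (hy : y ∈ Set.Icc (0 : Fin n → ℝ) 1) (hz : z ∈ Set.Icc (0 : Fin n → ℝ) 1) :
    (f y - f z) ^ 2 ≤ n * K := by
  obtain ⟨t, -, ht⟩ := domain_mvt (s := Set.univ) (f' := fderiv ℝ f) (x := z) (y := y)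
    (fun x _ => (hf x).hasFDerivAt.hasFDerivWithinAt) convex_univ trivial trivial
  rw [ht, fderiv_eq_sum_pd]
  refine (Finset.sum_mul_sq_le_sq_mul_sq _ _ _).trans ?_
  refine mul_le_mul ?_ (hK t) (Finset.sum_nonneg fun _ _ => sq_nonneg _) (Nat.cast_nonneg n)
  refine (Finset.sum_le_card_nsmul _ _ 1 fun i _ => ?_).trans (by simp)
  have h1 := hy.1 i
  have h2 := hy.2 i
  have h3 := hz.1 i
  have h4 := hz.2 i
  simp at h1 h2 h3 h4
  simp only [Pi.sub_apply]
  nlinarith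

theorem nonpos_of_setIntegral_eq_zero {n : ℕ} {f : (Fin n → ℝ) → ℝ} (hf : Continuous f)
    (hint : ∫ x in Set.Icc ((fun _ => -(1/2)) : Fin n → ℝ) (fun _ => 1/2), f x = 0) {c : ℝ}
    (hc : ∀ x, c ≤ f x) : c ≤ 0 := by
  have hvol : volume.real (Set.Icc ((fun _ => -(1/2)) : Fin n → ℝ) (fun _ => 1/2)) = 1 := by
    rw [Measure.real, Real.volume_Icc_pi]
    norm_num
  have h := setIntegral_mono (μ := volume) (f := fun _ => c)
    (s := Set.Icc ((fun _ => -(1/2)) : Fin n → ℝ) (fun _ => 1/2))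
    (continuous_const.integrableOn_Icc) hf.integrableOn_Icc hc
  rw [hint, setIntegral_const, hvol, one_smul] at h
  exact h

theorem abs_le_of_setIntegral_eq_zero {n : ℕ} {f : (Fin n → ℝ) → ℝ} (hf : Continuous f)
    (hint : ∫ x in Set.Icc ((fun _ => -(1/2)) : Fin n → ℝ) (fun _ => 1/2), f x = 0) {a b : ℝ}
    (ha : ∀ x, a ≤ f x) (hb : ∀ x, f x ≤ b) (x : Fin n → ℝ) : |f x| ≤ b - a := by
  have h1 := nonpos_of_setIntegral_eq_zero hf hint ha
  have h2 := nonpos_of_setIntegral_eq_zero (f := fun x => -f x) hf.neg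
    (by rw [integral_neg, hint, neg_zero]) (fun x => neg_le_neg (hb x))
  rw [abs_le]
  constructor <;> linarith [ha x, hb x]

/-- A priori `C¹`-estimate for solutions of the quaternionic Monge–Ampère equation on `T⁵`. -/
theorem C1_estimate :
    ∃ C₂ : ℝ → ℝ,
      ∀ F φ : (Fin 5 → ℝ) → ℝ,
        ContDiff ℝ 2 F → PeriodicPi F →
        (∫ x in Set.Icc (0 : Fin 5 → ℝ) 1, (Real.exp (F x) - 1) = 0) →
        ContDiff ℝ 4 φ → PeriodicPi φ →
        (∫ x in Set.Icc ((fun _ => -(1/2)) : Fin 5 → ℝ) (fun _ => 1/2), φ x) = 0 →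
        EqStar F φ →
        CNorm 1 φ ≤ C₂ (CNorm 2 F) := by
  refine ⟨fun N => 2 + 5 * (1 + 16 * Real.exp N * (1 + 35 * N ^ 2)), ?_⟩
  intro F φ hF hFper _ hφ hper hint h
  set N := CNorm 2 F
  have hN : ∀ x, |F x| ≤ N := fun x => by
    have := abs_pdI_le_CNorm (k := 2) (f := F) (I := 0) (by simp)
      (by rw [pdI_zero]; exact hFper.bddAbove_abs hF.continuous) x
    rwa [pdI_zero] at this
  have hN' : ∀ k x, |pd k F x| ≤ N := fun k x => by
    have := abs_pdI_le_CNorm (k := 2) (f := F) (I := Pi.single k 1) (by simp)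
      (by
        rw [pdI_single]
        exact (hFper.pd k).bddAbove_abs (contDiff_pd (k := 1) hF (by norm_num) k).continuous) x
    rwa [pdI_single] at this
  have hdφ : ∀ k, Continuous (pd k φ) := fun k =>
    (contDiff_pd (k := 3) hφ (by norm_num) k).continuous
  obtain ⟨z, hz, hmin⟩ := hper.exists_min hφ.continuous
  obtain ⟨y, hy, hmax⟩ := hper.exists_max hφ.continuous
  have hs : ∀ x, 0 < 1 + φ x - φ z := fun x => by linarith [hmin x]
  obtain ⟨x, -, hx⟩ := PeriodicPi.exists_max
    (f := fun x => (1 + ∑ k, pd k φ x ^ 2) / (1 + φ x - φ z))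
    (fun x i => by simp only [hper x i, (hper.pd _) x i])
    (Continuous.div (by fun_prop) (by have := hφ.continuous; fun_prop) fun x => (hs x).ne')
  set m := (1 + ∑ k, pd k φ x ^ 2) / (1 + φ x - φ z) with hm
  have hm0 : 0 < m :=
    div_pos (add_pos_of_pos_of_nonneg one_pos (Finset.sum_nonneg fun _ _ => sq_nonneg _)) (hs x)
  have hle : ∀ w, 1 + ∑ k, pd k φ w ^ 2 ≤ m * (1 + φ w - φ z) := fun w =>
    (div_le_iff₀ (hs w)).mp (hx w)
  have hxeq : 1 + ∑ k, pd k φ x ^ 2 = m * (1 + φ x - φ z) :=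
    (div_eq_iff (hs x).ne').mp hm.symm
  set S := 1 + φ y - φ z with hSdef
  have hS1 : 1 ≤ S := by linarith [hmin y]
  have hgrad : ∀ w, ∑ k, pd k φ w ^ 2 ≤ m * S := fun w => by
    have : m * (1 + φ w - φ z) ≤ m * S :=
      mul_le_mul_of_nonneg_left (by linarith [hmax w]) hm0.le
    linarith [hle w]
  have hosc := sq_sub_le_of_sum_sq_pd_le (hφ.differentiable (by norm_num)) hgrad hy hz
  have hSm : S ≤ 2 + 5 * m := by
    have hyz : φ y - φ z = S - 1 := by rw [hSdef]; ring
    rw [hyz] at hosc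
    push_cast at hosc
    by_contra! hlt
    nlinarith
  set K := 1 + 16 * Real.exp N * (1 + 35 * N ^ 2) with hK
  have hK1 : 1 ≤ K := by
    have : 0 ≤ 16 * Real.exp N * (1 + 35 * N ^ 2) := by positivity
    linarith
  have hmK : m ≤ K := by
    rcases le_or_gt m 1 with h1 | h1
    · exact h1.trans hK1
    · have := h.quotient_le hF hφ hper h1 hle hxeq (hmin x) (by linarith [hmax x]) hSm (hN x)
        fun k => hN' k x
      linarith
  refine CNorm_one_le (by linarith) (fun w => ?_) fun i w => ?_
  · have := abs_le_of_setIntegral_eq_zero hφ.continuous hint hmin hmax w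
    linarith
  · refine abs_le_of_sq_le_sq ?_ (by linarith)
    calc pd i φ w ^ 2 ≤ ∑ k, pd k φ w ^ 2 :=
          Finset.single_le_sum (f := fun k => pd k φ w ^ 2) (fun _ _ => sq_nonneg _)
            (Finset.mem_univ i)
      _ ≤ m * S := hgrad w
      _ ≤ (2 + 5 * K) * (2 + 5 * K) := by gcongr <;> linarith
      _ = _ := by ring
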